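/- arXiv:gr-qc/0406004 — 2 statements merged into one kernel-verified Lean document; each statement's English description precedes it below -/
import Mathlib

section
/- Let ℏ > 0, m > 0, and let P, S, V : ℝ × ℝ → ℝ be smooth with P everywhere positive. If S and P satisfy the modified Hamilton–Jacobi equation ∂_t S + (∂_x S)²/(2m) + V + (λ/m)[(∂_x P / P)² − 2 ∂_x² P / P] = 0 with λ = ℏ²/8, together with the continuity equation ∂_t P + ∂_x(P ∂_x S / m) = 0, then ψ := √P · exp(iS/ℏ) satisfies the Schrödinger equation iℏ ∂_t ψ = −(ℏ²/2m) ∂_x² ψ + Vψ. -/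
noncomputable section

/-- The logarithmic derivative of a wave function in polar form `√p · exp(is/ℏ)`. -/
theorem hasDerivAt_sqrt_mul_exp {p s : ℝ → ℝ} {p' s' ℏ x : ℝ} (hp : HasDerivAt p p' x)
    (hs : HasDerivAt s s' x) (hpos : 0 < p x) {φ : ℝ → ℂ}
    (hφ : ∀ y, φ y =
      (Real.sqrt (p y) : ℂ) * Complex.exp (Complex.I * (s y : ℂ) / (ℏ : ℂ))) :
    HasDerivAt φ (((p' / (2 * p x) : ℝ) + Complex.I * (s' / ℏ : ℝ)) * φ x) x := by
  obtain rfl := funext hφ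
  have h_sqrt : p' / (2 * Real.sqrt (p x)) = p' / (2 * p x) * Real.sqrt (p x) := by
    have hne := (Real.sqrt_pos.2 hpos).ne'
    have hsq := Real.sq_sqrt hpos.le
    field_simp
    linear_combination -p' * hsq
  have hR := (hp.sqrt hpos.ne').ofReal_comp
  have hE := ((hs.ofReal_comp.const_mul Complex.I).div_const (ℏ : ℂ)).cexp
  rw [h_sqrt] at hR
  refine (hR.mul hE).congr_deriv ?_
  push_cast
  ring

/-- Converse Madelung statement: if `(S, P)` solve the Hamilton–Jacobi equation modified by the
Fisher-information term `(λ/m)[(P'/P)² − 2P''/P]` with `λ = ℏ²/8`, together with the continuity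
equation, then `ψ := √P · exp(iS/ℏ)` satisfies the Schrödinger equation. -/
theorem fisher_quantization
    (ℏ m : ℝ) (hℏ : 0 < ℏ) (hm : 0 < m)
    (P S V : ℝ → ℝ → ℝ)
    (hP : ContDiff ℝ (⊤ : ℕ∞) (fun p : ℝ × ℝ => P p.1 p.2))
    (hS : ContDiff ℝ (⊤ : ℕ∞) (fun p : ℝ × ℝ => S p.1 p.2))
    (hV : ContDiff ℝ (⊤ : ℕ∞) (fun p : ℝ × ℝ => V p.1 p.2))
    (hpos : ∀ t x, 0 < P t x)
    (lam : ℝ) (hlam : lam = ℏ ^ 2 / 8)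
    (hHJ : ∀ t x, deriv (fun τ => S τ x) t + (deriv (S t) x) ^ 2 / (2 * m) + V t x +
      (lam / m) * ((deriv (P t) x / P t x) ^ 2 - 2 * deriv (deriv (P t)) x / P t x) = 0)
    (hcont : ∀ t x,
      deriv (fun τ => P τ x) t + deriv (fun y => P t y * deriv (S t) y / m) x = 0)
    (ψ : ℝ → ℝ → ℂ)
    (hψ : ∀ t x, ψ t x =
      (Real.sqrt (P t x) : ℂ) * Complex.exp (Complex.I * (S t x : ℂ) / (ℏ : ℂ))) :
    ∀ t x, Complex.I * (ℏ : ℂ) * deriv (fun τ => ψ τ x) t =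
      -((ℏ : ℂ) ^ 2 / (2 * (m : ℂ))) * deriv (deriv (ψ t)) x + (V t x : ℂ) * ψ t x := by
  intro t x
  have smooth_space {F : ℝ → ℝ → ℝ}
      (hF : ContDiff ℝ (⊤ : ℕ∞) (fun p : ℝ × ℝ => F p.1 p.2)) : ContDiff ℝ (⊤ : ℕ∞) (F t) :=
    hF.comp (contDiff_const.prodMk contDiff_id)
  have smooth_time {F : ℝ → ℝ → ℝ}
      (hF : ContDiff ℝ (⊤ : ℕ∞) (fun p : ℝ × ℝ => F p.1 p.2)) :
      ContDiff ℝ (⊤ : ℕ∞) (fun τ => F τ x) :=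
    hF.comp (contDiff_id.prodMk contDiff_const)
  have hasDerivAt_space {f : ℝ → ℝ} (hf : ContDiff ℝ (⊤ : ℕ∞) f) (y : ℝ) :
      HasDerivAt f (deriv f y) y :=
    (hf.differentiable (by simp) y).hasDerivAt
  have hasDerivAt_deriv {f : ℝ → ℝ} (hf : ContDiff ℝ (⊤ : ℕ∞) f) :
      HasDerivAt (deriv f) (deriv (deriv f) x) x :=
    hasDerivAt_space (contDiff_infty_iff_deriv.1 hf).2 x
  have hP1 := hasDerivAt_space (smooth_space hP)
  have hS1 := hasDerivAt_space (smooth_space hS)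
  have hP2 := hasDerivAt_deriv (smooth_space hP)
  have hS2 := hasDerivAt_deriv (smooth_space hS)
  have hψ_time := hasDerivAt_sqrt_mul_exp (hasDerivAt_space (smooth_time hP) t)
    (hasDerivAt_space (smooth_time hS) t) (hpos t x) (fun τ => hψ τ x)
  have hψ_space (y : ℝ) := hasDerivAt_sqrt_mul_exp (hP1 y) (hS1 y) (hpos t y) (hψ t)
  have hψ_deriv := funext fun y => (hψ_space y).deriv
  have hψ_deriv2 : deriv (fun y => ((deriv (P t) y / (2 * P t y) : ℝ) +
      Complex.I * (deriv (S t) y / ℏ : ℝ)) * ψ t y) x = _ :=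
    (((hP2.div ((hP1 x).const_mul 2) (mul_pos two_pos (hpos t x)).ne').ofReal_comp.add
      ((hS2.div_const ℏ).ofReal_comp.const_mul Complex.I)).mul (hψ_space x)).deriv
  have h_cont := hcont t x
  have h_flux : deriv (fun y => P t y * deriv (S t) y / m) x = _ :=
    (((hP1 x).mul hS2).div_const m).deriv
  rw [h_flux] at h_cont
  have h_HJ := hHJ t x
  rw [hψ_deriv, hψ_time.deriv, hψ_deriv2]
  simp only [Pi.add_apply, Pi.div_apply]
  have hPne : (P t x : ℂ) ≠ 0 := Complex.ofReal_ne_zero.2 (hpos t x).ne'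
  have hm' : (m : ℂ) ≠ 0 := Complex.ofReal_ne_zero.2 hm.ne'
  have h_ℏ : (ℏ : ℂ) ≠ 0 := Complex.ofReal_ne_zero.2 hℏ.ne'
  have c_cont := congrArg (Complex.ofReal) h_cont
  have c_HJ := congrArg (Complex.ofReal) h_HJ
  rw [hlam] at c_HJ
  push_cast at c_cont c_HJ ⊢
  rw [add_assoc, add_assoc] at c_HJ
  rw [eq_neg_of_add_eq_zero_left c_cont, eq_neg_of_add_eq_zero_left c_HJ]
  field_simp
  ring_nf
  simp only [Complex.I_sq]
  ring
end
end

section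
/- Let U ⊆ ℝⁿ be open, let g be a smooth map from U to symmetric invertible n×n real matrices, κ a smooth covector field on U, n₀ ∈ ℤ, and S : U → ℝ smooth. Define the modified connection *Γ^α_{μν} := {α;μν} − δ^α_μ κ_ν − δ^α_ν κ_μ + g_{μν} κ^α (where {α;μν} are the Christoffel symbols of g and κ^α = Σ_β g^{αβ} κ_β), the co-covariant derivative S_{*μ} := ∂_μ S − n₀ κ_μ S, and the second co-covariant derivative S_{*μ*ν} := ∂_ν S_{*μ} − n₀ κ_ν S_{*μ} − Σ_α *Γ^α_{μν} S_{*α}. Then for all μ, ν: S_{*μ*ν} − S_{*ν*μ} = −n₀ F_{μν} S, where F_{μν} := ∂_ν κ_μ − ∂_μ κ_ν. -/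
noncomputable section

/-- Partial derivative within `U` in direction `i` of a real-valued function on `ℝⁿ`. -/
def pdW {n : ℕ} (U : Set (Fin n → ℝ)) (i : Fin n) (f : (Fin n → ℝ) → ℝ)
    (x : Fin n → ℝ) : ℝ :=
  fderivWithin ℝ f U x (Pi.single i 1)

/-- Christoffel symbols `{α;μν}` of a metric `g`, with derivatives taken within `U`. -/
def christoffel {n : ℕ} (U : Set (Fin n → ℝ))
    (g : (Fin n → ℝ) → Matrix (Fin n) (Fin n) ℝ)
    (x : Fin n → ℝ) (a b c : Fin n) : ℝ :=
  (1 / 2) * ∑ l, (g x)⁻¹ a l *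
    (pdW U c (fun y => g y b l) x + pdW U b (fun y => g y l c) x -
      pdW U l (fun y => g y b c) x)

/-- Dirac's modified connection `*Γ^α_{μν} = {α;μν} − δ^α_μ κ_ν − δ^α_ν κ_μ + g_{μν} κ^α`. -/
def starGamma {n : ℕ} (U : Set (Fin n → ℝ))
    (g : (Fin n → ℝ) → Matrix (Fin n) (Fin n) ℝ)
    (κ : (Fin n → ℝ) → Fin n → ℝ) (x : Fin n → ℝ) (a μ ν : Fin n) : ℝ :=
  christoffel U g x a μ ν - (if a = μ then 1 else 0) * κ x ν -
    (if a = ν then 1 else 0) * κ x μ + g x μ ν * (∑ b, (g x)⁻¹ a b * κ x b)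

/-- The co-covariant derivative `S_{*μ} = ∂_μ S − n₀ κ_μ S` of a co-scalar of power `n₀`. -/
def coDeriv {n : ℕ} (U : Set (Fin n → ℝ)) (κ : (Fin n → ℝ) → Fin n → ℝ) (n₀ : ℤ)
    (S : (Fin n → ℝ) → ℝ) (x : Fin n → ℝ) (μ : Fin n) : ℝ :=
  pdW U μ S x - (n₀ : ℝ) * κ x μ * S x

/-- The second co-covariant derivative
`S_{*μ*ν} = ∂_ν S_{*μ} − n₀ κ_ν S_{*μ} − Σ_α *Γ^α_{μν} S_{*α}`. -/
def coDeriv2 {n : ℕ} (U : Set (Fin n → ℝ))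
    (g : (Fin n → ℝ) → Matrix (Fin n) (Fin n) ℝ)
    (κ : (Fin n → ℝ) → Fin n → ℝ) (n₀ : ℤ)
    (S : (Fin n → ℝ) → ℝ) (x : Fin n → ℝ) (μ ν : Fin n) : ℝ :=
  pdW U ν (fun y => coDeriv U κ n₀ S y μ) x - (n₀ : ℝ) * κ x ν * coDeriv U κ n₀ S x μ -
    ∑ a, starGamma U g κ x a μ ν * coDeriv U κ n₀ S x a

lemma pdW_congr {n : ℕ} {U : Set (Fin n → ℝ)} {f f' : (Fin n → ℝ) → ℝ} (h : Set.EqOn f f' U)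
    {x : Fin n → ℝ} (hx : x ∈ U) (i : Fin n) : pdW U i f x = pdW U i f' x := by
  unfold pdW
  rw [fderivWithin_congr h (h hx)]

lemma christoffel_comm {n : ℕ} {U : Set (Fin n → ℝ)}
    {g : (Fin n → ℝ) → Matrix (Fin n) (Fin n) ℝ}
    (hsym : ∀ x ∈ U, ∀ i j, g x i j = g x j i) {x : Fin n → ℝ} (hx : x ∈ U)
    (a b c : Fin n) : christoffel U g x a b c = christoffel U g x a c b := by
  have hpd : ∀ k i j, pdW U k (fun y => g y i j) x = pdW U k (fun y => g y j i) x :=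
    fun k i j => pdW_congr (fun y hy => hsym y hy i j) hx k
  unfold christoffel
  congr 1
  refine Finset.sum_congr rfl fun l _ => ?_
  rw [hpd c b l, hpd b l c, hpd l b c]
  ring

lemma starGamma_comm {n : ℕ} {U : Set (Fin n → ℝ)}
    {g : (Fin n → ℝ) → Matrix (Fin n) (Fin n) ℝ}
    (hsym : ∀ x ∈ U, ∀ i j, g x i j = g x j i) (κ : (Fin n → ℝ) → Fin n → ℝ)
    {x : Fin n → ℝ} (hx : x ∈ U) (a μ ν : Fin n) :
    starGamma U g κ x a μ ν = starGamma U g κ x a ν μ := by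
  unfold starGamma
  rw [christoffel_comm hsym hx a μ ν, hsym x hx μ ν]
  ring

lemma differentiableOn_pdW {n : ℕ} {U : Set (Fin n → ℝ)} (hU : IsOpen U)
    {f : (Fin n → ℝ) → ℝ} (hf : ContDiffOn ℝ 2 f U) (i : Fin n) :
    DifferentiableOn ℝ (pdW U i f) U :=
  ((hf.fderivWithin hU.uniqueDiffOn (m := 1) (by norm_num)).differentiableOn
    one_ne_zero).clm_apply (differentiableOn_const _)

/-- Equality of mixed second partial derivatives. -/
lemma pdW_pdW_comm {n : ℕ} {U : Set (Fin n → ℝ)} (hU : IsOpen U)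
    {f : (Fin n → ℝ) → ℝ} (hf : ContDiffOn ℝ 2 f U) {x : Fin n → ℝ} (hx : x ∈ U)
    (i j : Fin n) : pdW U i (pdW U j f) x = pdW U j (pdW U i f) x := by
  have hd : DifferentiableWithinAt ℝ (fderivWithin ℝ f U) U x :=
    (hf.fderivWithin hU.uniqueDiffOn (m := 1) (by norm_num)).differentiableOn one_ne_zero x hx
  have happly : ∀ k l, pdW U k (pdW U l f) x =
      fderivWithin ℝ (fderivWithin ℝ f U) U x (Pi.single k 1) (Pi.single l 1) := by
    intro k l
    change fderivWithin ℝ (fun y => fderivWithin ℝ f U y (Pi.single l 1)) U x _ = _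
    rw [fderivWithin_clm_apply (hU.uniqueDiffWithinAt hx) hd (differentiableWithinAt_const _)]
    simp
  rw [happly, happly]
  exact ((hf x hx).isSymmSndFDerivWithinAt (by simp) hU.uniqueDiffOn
    (subset_closure (hU.interior_eq.symm ▸ hx)) hx).eq _ _

lemma pdW_coDeriv {n : ℕ} {U : Set (Fin n → ℝ)} (hU : IsOpen U)
    {κ : (Fin n → ℝ) → Fin n → ℝ} {μ : Fin n} (hκ : DifferentiableOn ℝ (fun y => κ y μ) U)
    (n₀ : ℤ) {S : (Fin n → ℝ) → ℝ} (hS : ContDiffOn ℝ 2 S U) {x : Fin n → ℝ} (hx : x ∈ U)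
    (ν : Fin n) :
    pdW U ν (fun y => coDeriv U κ n₀ S y μ) x =
      pdW U ν (pdW U μ S) x -
        (n₀ : ℝ) * (pdW U ν (fun y => κ y μ) x * S x + κ x μ * pdW U ν S x) := by
  have hu := hU.uniqueDiffWithinAt (𝕜 := ℝ) hx
  have h₁ := differentiableOn_pdW hU hS μ x hx
  have h₂ := (hκ x hx).const_mul (n₀ : ℝ)
  have h₃ := hS.differentiableOn two_ne_zero x hx
  unfold coDeriv
  rw [pdW, fderivWithin_fun_sub hu h₁ (h₂.fun_mul h₃), fderivWithin_fun_mul hu h₂ h₃,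
    fderivWithin_const_mul hu (hκ x hx)]
  simp only [pdW, sub_apply, add_apply,
    smul_apply, smul_eq_mul]
  ring

/-- Dirac's identity (D18): the commutator of co-covariant derivatives on a co-scalar `S`
of power `n₀` equals `−n₀ F_{μν} S` with `F_{μν} = ∂_ν κ_μ − ∂_μ κ_ν`. -/
theorem coDeriv2_commutator
    {n : ℕ} (U : Set (Fin n → ℝ)) (hU : IsOpen U)
    (g : (Fin n → ℝ) → Matrix (Fin n) (Fin n) ℝ)
    (hg : ∀ i j, ContDiffOn ℝ (⊤ : ℕ∞) (fun x => g x i j) U)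
    (hsym : ∀ x ∈ U, ∀ i j, g x i j = g x j i)
    (hinv : ∀ x ∈ U, IsUnit (g x).det)
    (κ : (Fin n → ℝ) → Fin n → ℝ)
    (hκ : ∀ i, ContDiffOn ℝ (⊤ : ℕ∞) (fun x => κ x i) U)
    (n₀ : ℤ)
    (S : (Fin n → ℝ) → ℝ) (hS : ContDiffOn ℝ (⊤ : ℕ∞) S U) :
    ∀ x ∈ U, ∀ μ ν : Fin n,
      coDeriv2 U g κ n₀ S x μ ν - coDeriv2 U g κ n₀ S x ν μ =
        -(n₀ : ℝ) * (pdW U ν (fun y => κ y μ) x - pdW U μ (fun y => κ y ν) x) * S x := by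
  intro x hx μ ν
  have hS2 : ContDiffOn ℝ 2 S U := hS.of_le (WithTop.coe_le_coe.2 le_top)
  have hκd : ∀ i, DifferentiableOn ℝ (fun y => κ y i) U :=
    fun i => (hκ i).differentiableOn (by simp)
  have hΓ : ∑ a, starGamma U g κ x a μ ν * coDeriv U κ n₀ S x a =
      ∑ a, starGamma U g κ x a ν μ * coDeriv U κ n₀ S x a :=
    Finset.sum_congr rfl fun a _ => by rw [starGamma_comm hsym κ hx a μ ν]
  unfold coDeriv2
  rw [hΓ, pdW_coDeriv hU (hκd μ) n₀ hS2 hx ν, pdW_coDeriv hU (hκd ν) n₀ hS2 hx μ,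
    pdW_pdW_comm hU hS2 hx μ ν]
  simp only [coDeriv]
  ring
end
end
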